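/- Suppose the sequence (a_j) has Property (★), i.e. max_{1≤j≤n−1} s_n(j)/H_n(j) → 0 as n → ∞. Then the normalized Vandermonde determinants of the fast Leja points converge to the transfinite diameter of [0,1]: lim_{n→∞} ( ∏_{0 ≤ j < k ≤ n} |a_j − a_k| )^{2/(n(n+1))} = 1/4. -/

import Mathlib

open Filter

/-- `p_n(x) = ∏_{j=0}^{n-1} (x - a_j)`. -/
noncomputable def lejaPoly (a : ℕ → ℝ) (n : ℕ) (x : ℝ) : ℝ :=
  ∏ j ∈ Finset.range n, (x - a j)

/-- The candidate set `M_n`: midpoints `(x+y)/2` of pairs `x < y` of points among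
`a₀, …, a_{n-1}` with no `a_l` (`l < n`) strictly between them. -/
def midCandidates (a : ℕ → ℝ) (n : ℕ) : Set ℝ :=
  {m | ∃ i j, i < n ∧ j < n ∧ a i < a j ∧
    (∀ l, l < n → ¬(a i < a l ∧ a l < a j)) ∧ m = (a i + a j) / 2}

/-- Half-gap `s_n(j) = (ζ_{nj} + ζ_{n(j+1)})/2 - ζ_{nj}` of the sorted row. -/
noncomputable def sgap (ζ : ℕ → ℕ → ℝ) (n j : ℕ) : ℝ :=
  (ζ n j + ζ n (j + 1)) / 2 - ζ n j

/-- `H_n(j) = ((1/n) ∑_{k=1}^n 1/|m_{nj} - ζ_{nk}|)⁻¹` for the sorted row. -/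
noncomputable def Hfun (ζ : ℕ → ℕ → ℝ) (n j : ℕ) : ℝ :=
  ((1 / (n : ℝ)) * ∑ k ∈ Finset.Icc 1 n,
      1 / |(ζ n j + ζ n (j + 1)) / 2 - ζ n k|)⁻¹

open Polynomial in
/-- A monic polynomial of degree `n` bounded by `M` on `[-1, 1]` satisfies `1 ≤ M * 2 ^ (n - 1)`. -/
theorem one_le_mul_two_pow_of_monic {n : ℕ} {P : ℝ[X]} (hP : P.Monic) (hdeg : P.natDegree = n)
    {M : ℝ} (hM : 0 < M) (hbd : ∀ x ∈ Set.Icc (-1 : ℝ) 1, |P.eval x| ≤ M) :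
    1 ≤ M * 2 ^ (n - 1) := by
  have h := Polynomial.Chebyshev.leadingCoeff_le_of_forall_abs_le_one (n := n) (P := C M⁻¹ * P)
    ?_ ?_
  · rw [leadingCoeff_mul, leadingCoeff_C, hP.leadingCoeff, mul_one] at h
    rwa [inv_le_iff_one_le_mul₀' hM] at h
  · rw [degree_C_mul (inv_ne_zero hM.ne')]
    exact degree_le_of_natDegree_le hdeg.le
  · intro x hx
    rw [eval_mul, eval_C, abs_mul, abs_of_pos (inv_pos.mpr hM), inv_mul_le_iff₀ hM, mul_one]
    exact hbd x hx

/-- The Chebyshev lower bound for the sup norm of `p_n` on `[0, 1]`. -/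
theorem inv_four_pow_le_of_lejaPoly_le (a : ℕ → ℝ) (n : ℕ) {M : ℝ} (hM : 0 < M)
    (hbd : ∀ x ∈ Set.Icc (0 : ℝ) 1, |lejaPoly a n x| ≤ M) : ((4 : ℝ) ^ n)⁻¹ ≤ M := by
  have h := one_le_mul_two_pow_of_monic (n := n)
    (P := ∏ j ∈ Finset.range n, (Polynomial.X - Polynomial.C (2 * a j - 1)))
    (Polynomial.monic_prod_of_monic _ _ fun j _ => Polynomial.monic_X_sub_C _)
    (Polynomial.natDegree_finsetProd_X_sub_C_eq_card _ _ |>.trans (Finset.card_range n))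
    (M := 2 ^ n * M) (by positivity) ?_
  · rw [inv_le_iff_one_le_mul₀' (by positivity)]
    calc (1 : ℝ) ≤ 2 ^ n * M * 2 ^ (n - 1) := h
      _ ≤ 2 ^ n * M * 2 ^ n := by
        gcongr
        · norm_num
        · omega
      _ = 4 ^ n * M := by
        rw [show (4 : ℝ) = 2 * 2 by norm_num, mul_pow]
        ring
  · intro x hx
    have hval : (∏ j ∈ Finset.range n,
        (Polynomial.X - Polynomial.C (2 * a j - 1))).eval x
          = 2 ^ n * lejaPoly a n ((x + 1) / 2) := by
      rw [Polynomial.eval_prod, lejaPoly, ← Finset.card_range n, ← Finset.prod_const,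
        Finset.card_range, ← Finset.prod_mul_distrib]
      refine Finset.prod_congr rfl fun j _ => ?_
      simp only [Polynomial.eval_sub, Polynomial.eval_X, Polynomial.eval_C]
      ring
    rw [hval, abs_mul, abs_of_pos (by positivity : (0 : ℝ) < 2 ^ n)]
    have := hbd ((x + 1) / 2) ⟨by linarith [hx.1], by linarith [hx.2]⟩
    gcongr

open Polynomial in
/-- Vandermonde determinants of points of `[-1, 1]`, bounded through the Chebyshev basis. -/
theorem abs_det_vandermonde_le {n : ℕ} (v : Fin n → ℝ) (hv : ∀ i, |v i| ≤ 1) :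
    |(Matrix.vandermonde v).det| ≤ n.factorial * ∏ k ∈ Finset.range n, (2 * (2 ^ k)⁻¹ : ℝ) := by
  have hlead : ∀ k : ℕ, (Chebyshev.T ℝ (k : ℤ)).leadingCoeff = 2 ^ (k - 1) := by
    intro k
    simp
  rw [Matrix.det_eval_matrixOfPolynomials_eq_det_vandermonde v
    (fun k => C ((2 ^ ((k : ℕ) - 1) : ℝ)⁻¹) * Chebyshev.T ℝ ((k : ℕ) : ℤ)), Matrix.det_apply]
  · calc _ ≤ ∑ σ : Equiv.Perm (Fin n), ∏ k ∈ Finset.range n, (2 * (2 ^ k)⁻¹ : ℝ) := by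
          refine (Finset.abs_sum_le_sum_abs _ _).trans (Finset.sum_le_sum fun σ _ => ?_)
          rw [Finset.prod_range, ← AbsoluteValue.abs_apply, AbsoluteValue.map_units_int_smul,
            AbsoluteValue.map_prod]
          refine Finset.prod_le_prod (fun i _ => abs_nonneg _) fun i _ => ?_
          rw [AbsoluteValue.abs_apply, Matrix.of_apply, eval_mul, eval_C, abs_mul,
            abs_of_pos (by positivity)]
          have h1 := Chebyshev.abs_eval_T_real_le_one ((i : ℕ) : ℤ) (hv (σ i))
          have h2 : ((2 : ℝ) ^ ((i : ℕ) - 1))⁻¹ ≤ 2 * (2 ^ (i : ℕ))⁻¹ := by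
            rcases Nat.eq_zero_or_pos (i : ℕ) with h0 | h0
            · rw [h0]
              norm_num
            · obtain ⟨m, hm⟩ := Nat.exists_eq_succ_of_ne_zero h0.ne'
              rw [hm, Nat.succ_sub_one, pow_succ, mul_inv]
              linarith
          calc _ ≤ 2 * (2 ^ (i : ℕ))⁻¹ * (1 : ℝ) := by gcongr
            _ = _ := mul_one _
      _ = _ := by
          rw [Finset.sum_const, Finset.card_univ, Fintype.card_perm, Fintype.card_fin,
            nsmul_eq_mul]
  · intro k
    rw [natDegree_C_mul (by positivity)]
    simp
  · intro k
    rw [Monic, leadingCoeff_mul, leadingCoeff_C, hlead, inv_mul_cancel₀ (by positivity)]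

/-- The triangular product of distances is the absolute value of a Vandermonde determinant. -/
theorem abs_det_vandermonde_eq_prod_range (b : ℕ → ℝ) (n : ℕ) :
    |(Matrix.vandermonde fun i : Fin n => b i).det|
      = ∏ k ∈ Finset.range n, ∏ j ∈ Finset.range k, |b j - b k| := by
  rw [Matrix.det_vandermonde, Finset.abs_prod, Finset.prod_range]
  simp_rw [Finset.abs_prod]
  rw [Finset.prod_comm' (t' := Finset.univ) (s' := fun k : Fin n => Finset.Iio k) (by simp)]
  refine Finset.prod_congr rfl fun k _ => ?_
  refine Finset.prod_bij (fun j _ => (j : ℕ)) (fun j hj => ?_) (fun i _ j _ h => Fin.ext h)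
    (fun j hj => ?_) (fun j _ => abs_sub_comm _ _)
  · simpa using hj
  · rw [Finset.mem_range] at hj
    exact ⟨⟨j, hj.trans k.2⟩, by simpa [Fin.lt_def] using hj, rfl⟩

theorem sum_range_succ_cast_eq (n : ℕ) :
    ∑ k ∈ Finset.range (n + 1), (k : ℝ) = n * (n + 1) / 2 := by
  induction n with
  | zero => simp
  | succ n ih =>
    rw [Finset.sum_range_succ, ih]
    push_cast
    ring

/-- Logarithmic Fekete upper bound for `n + 1` distinct points of `[0, 1]`. -/
theorem sum_log_abs_lejaPoly_le (a : ℕ → ℝ) (hmem : ∀ j, a j ∈ Set.Icc (0 : ℝ) 1)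
    (hpos : ∀ n, 0 < |lejaPoly a n (a n)|) (n : ℕ) :
    ∑ k ∈ Finset.range (n + 1), Real.log |lejaPoly a k (a k)|
      ≤ (n + 1) * (Real.log (n + 1) + Real.log 2) - n * (n + 1) / 2 * Real.log 4 := by
  have h := abs_det_vandermonde_le (n := n + 1) (fun i => 2 * a i - 1) (fun i => by
    rw [abs_le]
    constructor <;> linarith [(hmem i).1, (hmem i).2])
  rw [abs_det_vandermonde_eq_prod_range (fun i => 2 * a i - 1)] at h
  have hprod : ∀ k ∈ Finset.range (n + 1),
      ∏ j ∈ Finset.range k, |(2 * a j - 1) - (2 * a k - 1)| = 2 ^ k * |lejaPoly a k (a k)| := by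
    intro k _
    have hpow : (2 : ℝ) ^ k = ∏ _j ∈ Finset.range k, 2 := by simp
    rw [lejaPoly, Finset.abs_prod, hpow, ← Finset.prod_mul_distrib]
    refine Finset.prod_congr rfl fun j _ => ?_
    rw [show (2 * a j - 1) - (2 * a k - 1) = -(2 * (a k - a j)) by ring, abs_neg, abs_mul, abs_two]
  rw [Finset.prod_congr rfl hprod] at h
  have hterm : ∀ k ∈ Finset.range (n + 1), Real.log (2 ^ k * |lejaPoly a k (a k)|)
      = k * Real.log 2 + Real.log |lejaPoly a k (a k)| := fun k _ => by
    rw [Real.log_mul (by positivity) (hpos k).ne', Real.log_pow]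
  have hcheb : ∀ k ∈ Finset.range (n + 1), Real.log (2 * (2 ^ k)⁻¹)
      = Real.log 2 - k * Real.log 2 := fun k _ => by
    rw [Real.log_mul (by positivity) (by positivity), Real.log_inv, Real.log_pow, sub_eq_add_neg]
  have hfac : ((n + 1).factorial : ℝ) ≤ ((n : ℝ) + 1) ^ (n + 1) := by
    exact_mod_cast Nat.factorial_le_pow (n + 1)
  have h3 := Real.log_le_log
    (Finset.prod_pos fun k _ => mul_pos (by positivity) (hpos k))
    (h.trans (mul_le_mul_of_nonneg_right hfac (by positivity)))
  rw [Real.log_mul (by positivity) (by positivity), Real.log_pow,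
    Real.log_prod (fun k _ => (mul_pos (by positivity) (hpos k)).ne'),
    Real.log_prod (fun k _ => by positivity),
    Finset.sum_congr rfl hterm, Finset.sum_congr rfl hcheb, Finset.sum_add_distrib, Finset.sum_sub_distrib, ← Finset.sum_mul, sum_range_succ_cast_eq,
    Finset.sum_const, Finset.card_range, nsmul_eq_mul] at h3
  have h4 : Real.log 4 = 2 * Real.log 2 := by
    rw [show (4 : ℝ) = 2 ^ 2 by norm_num, Real.log_pow]
    norm_num
  rw [h4]
  push_cast at h3
  linarith

/-- A finite family of distances grows at most exponentially when moving from `m` to `x`. -/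
theorem prod_abs_sub_le_mul_exp {ι : Type*} (s : Finset ι) (y : ι → ℝ) {m x r : ℝ}
    (hm : ∀ k ∈ s, m ≠ y k) (hx : |x - m| ≤ r) :
    ∏ k ∈ s, |x - y k| ≤ (∏ k ∈ s, |m - y k|) * Real.exp (r * ∑ k ∈ s, 1 / |m - y k|) := by
  rw [Finset.mul_sum, Real.exp_sum, ← Finset.prod_mul_distrib]
  refine Finset.prod_le_prod (fun k _ => abs_nonneg _) fun k hk => ?_
  have hpos : 0 < |m - y k| := abs_pos.mpr (sub_ne_zero.mpr (hm k hk))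
  calc |x - y k| ≤ |x - m| + |m - y k| := abs_sub_le _ _ _
    _ ≤ r + |m - y k| := by gcongr
    _ = |m - y k| * (r * (1 / |m - y k|) + 1) := by field_simp
    _ ≤ _ := by
      gcongr
      exact Real.add_one_le_exp _

theorem le_iSup_finset_mem (s : Finset ℕ) (f : ℕ → ℝ) {j : ℕ} (hj : j ∈ s) :
    f j ≤ ⨆ i ∈ s, f i := by
  refine le_ciSup_of_le (f := fun i => ⨆ (_ : i ∈ s), f i) ?_ j (by rw [ciSup_pos hj])
  refine ⟨∑ i ∈ s, |f i|, ?_⟩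
  rintro _ ⟨i, rfl⟩
  dsimp only
  by_cases hi : i ∈ s
  · rw [ciSup_pos hi]
    exact (le_abs_self _).trans (Finset.single_le_sum (f := fun i => |f i|)
      (fun _ _ => abs_nonneg _) hi)
  · have : IsEmpty (i ∈ s) := ⟨hi⟩
    rw [Real.iSup_of_isEmpty]
    positivity

/-- Every `x ∈ [0, 1)` lies in a gap of the sorted row. -/
theorem exists_gap {n : ℕ} (z : ℕ → ℝ) {x : ℝ}
    (hlow : ∃ k ∈ Finset.Icc 1 n, z k ≤ x) (hhigh : ∃ k ∈ Finset.Icc 1 n, x < z k)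
    (hmono : ∀ j k, 1 ≤ j → j < k → k ≤ n → z j < z k) :
    ∃ j ∈ Finset.Icc 1 (n - 1), z j ≤ x ∧ x < z (j + 1) := by
  obtain ⟨i, hi, hix⟩ := hlow
  obtain ⟨k, hk, hkx⟩ := hhigh
  rw [Finset.mem_Icc] at hi hk
  have hik : i < k := by
    by_contra! hki
    rcases hki.lt_or_eq with h | h
    · linarith [hmono k i hk.1 h hi.2]
    · subst h
      linarith
  have hex : ∃ d, x < z (i + d) := ⟨k - i, by rwa [Nat.add_sub_cancel' hik.le]⟩
  classical
  have hfind := Nat.find_spec hex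
  have hle : Nat.find hex ≤ k - i := Nat.find_min' hex (by rwa [Nat.add_sub_cancel' hik.le])
  obtain ⟨d, hd⟩ : ∃ d, Nat.find hex = d + 1 := Nat.exists_eq_succ_of_ne_zero fun h0 => by
    rw [h0, add_zero] at hfind
    linarith
  refine ⟨i + d, Finset.mem_Icc.mpr ⟨by omega, by omega⟩, ?_, ?_⟩
  · exact not_lt.mp (Nat.find_min hex (by omega))
  · rwa [hd] at hfind

/-- On `[0, 1]`, `p_n` exceeds its value at the next fast Leja point by at most the factor
`exp (n * max_j s_n(j) / H_n(j))`. -/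
theorem abs_lejaPoly_le_mul_exp {a : ℕ → ℝ} {n : ℕ} (hn : 2 ≤ n)
    (ha0 : a 0 = 0) (ha1 : a 1 = 1)
    (hleja : ∀ m ∈ midCandidates a n, |lejaPoly a n m| ≤ |lejaPoly a n (a n)|)
    (ζ : ℕ → ℕ → ℝ)
    (hmono : ∀ j k, 1 ≤ j → j < k → k ≤ n → ζ n j < ζ n k)
    (himage : (Finset.Icc 1 n).image (ζ n) = (Finset.range n).image a)
    (hinj : Function.Injective a) {x : ℝ} (hx : x ∈ Set.Icc (0 : ℝ) 1) :
    |lejaPoly a n x| ≤ |lejaPoly a n (a n)| *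
      Real.exp (n * ⨆ j ∈ Finset.Icc 1 (n - 1), sgap ζ n j / Hfun ζ n j) := by
  have hζinj : Set.InjOn (ζ n) (Finset.Icc 1 n) := by
    intro i hi j hj hij
    rw [Finset.mem_coe, Finset.mem_Icc] at hi hj
    rcases lt_trichotomy i j with h | h | h
    · exact absurd hij (hmono i j hi.1 h hj.2).ne
    · exact h
    · exact absurd hij (hmono j i hj.1 h hi.2).ne'
  have hpoly : ∀ y, |lejaPoly a n y| = ∏ k ∈ Finset.Icc 1 n, |y - ζ n k| := by
    intro y
    rw [lejaPoly, Finset.abs_prod, ← Finset.prod_image (f := fun t => |y - t|) hζinj, himage,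
      Finset.prod_image hinj.injOn]
  have hex : ∀ l < n, ∃ k ∈ Finset.Icc 1 n, ζ n k = a l := fun l hl =>
    Finset.mem_image.mp (himage ▸ Finset.mem_image_of_mem a (Finset.mem_range.mpr hl))
  have hex' : ∀ k ∈ Finset.Icc 1 n, ∃ l < n, a l = ζ n k := fun k hk => by
    obtain ⟨l, hl, h⟩ := Finset.mem_image.mp (himage ▸ Finset.mem_image_of_mem (ζ n) hk)
    exact ⟨l, Finset.mem_range.mp hl, h⟩
  rcases hx.2.eq_or_lt with rfl | hx1
  · have : lejaPoly a n 1 = 0 :=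
      Finset.prod_eq_zero (Finset.mem_range.mpr (by omega : 1 < n)) (by rw [ha1, sub_self])
    rw [this, abs_zero]
    positivity
  obtain ⟨k₀, hk₀, h₀⟩ := hex 0 (by omega)
  obtain ⟨k₁, hk₁, h₁⟩ := hex 1 (by omega)
  obtain ⟨j, hj, hjx, hxj⟩ := exists_gap (ζ n) (x := x) ⟨k₀, hk₀, by rw [h₀, ha0]; exact hx.1⟩
    ⟨k₁, hk₁, by rwa [h₁, ha1]⟩ hmono
  have hsup := le_iSup_finset_mem (Finset.Icc 1 (n - 1)) (fun j => sgap ζ n j / Hfun ζ n j) hj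
  rw [Finset.mem_Icc] at hj
  have hstep := hmono j (j + 1) hj.1 (by omega) (by omega)
  have hsep : ∀ k ∈ Finset.Icc 1 n, ζ n k ≤ ζ n j ∨ ζ n (j + 1) ≤ ζ n k := by
    intro k hk
    rw [Finset.mem_Icc] at hk
    rcases lt_trichotomy k j with h | h | h
    · exact Or.inl (hmono k j hk.1 h (by omega)).le
    · exact Or.inl (h ▸ le_rfl)
    · rcases (Nat.succ_le_of_lt h).eq_or_lt with h' | h'
      · exact Or.inr (h' ▸ le_rfl)
      · exact Or.inr (hmono (j + 1) k (by omega) h' hk.2).le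
  have hcand : (ζ n j + ζ n (j + 1)) / 2 ∈ midCandidates a n := by
    obtain ⟨l, hl, hlj⟩ := hex' j (Finset.mem_Icc.mpr ⟨hj.1, by omega⟩)
    obtain ⟨l', hl', hlj'⟩ := hex' (j + 1) (Finset.mem_Icc.mpr ⟨by omega, by omega⟩)
    refine ⟨l, l', hl, hl', by rwa [hlj, hlj'], fun i hi h => ?_, by rw [hlj, hlj']⟩
    obtain ⟨k, hk, hki⟩ := hex i hi
    rw [hlj, hlj', ← hki] at h
    rcases hsep k hk with h' | h' <;> linarith [h.1, h.2]
  have hbound := prod_abs_sub_le_mul_exp (Finset.Icc 1 n) (ζ n)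
    (m := (ζ n j + ζ n (j + 1)) / 2) (x := x) (r := sgap ζ n j)
    (fun k hk h => by rcases hsep k hk with h' | h' <;> linarith)
    (by rw [abs_le, sgap]; constructor <;> linarith)
  rw [← hpoly, ← hpoly] at hbound
  have hn0 : (0 : ℝ) < n := by exact_mod_cast (by omega : 0 < n)
  refine hbound.trans (mul_le_mul (hleja _ hcand) (Real.exp_le_exp.mpr ?_) (by positivity)
    (abs_nonneg _))
  calc _ = n * (sgap ζ n j / Hfun ζ n j) := by
        rw [Hfun, div_inv_eq_mul]
        field_simp
    _ ≤ _ := by gcongr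

/-- Theorem, main result.  If the fast Leja points `(a_j)` on
`[0,1]` (with midpoint candidates) satisfy Property (★), then the normalized
Vandermonde determinants converge to the transfinite diameter of `[0,1]`:
`(∏_{0 ≤ j < k ≤ n} |a_j - a_k|)^{2/(n(n+1))} → 1/4`. -/
theorem stmt_11
    (a : ℕ → ℝ)
    (hmem : ∀ j, a j ∈ Set.Icc (0 : ℝ) 1)
    (hinj : Function.Injective a)
    (ha0 : a 0 = 0) (ha1 : a 1 = 1)
    (hleja : ∀ n, 2 ≤ n → a n ∈ midCandidates a n ∧
      ∀ m ∈ midCandidates a n, |lejaPoly a n m| ≤ |lejaPoly a n (a n)|)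
    (ζ : ℕ → ℕ → ℝ)
    (hζmono : ∀ n, 2 ≤ n → ∀ j k, 1 ≤ j → j < k → k ≤ n → ζ n j < ζ n k)
    (hζimage : ∀ n, 2 ≤ n →
      (Finset.Icc 1 n).image (ζ n) = (Finset.range n).image a)
    (hstar : Tendsto (fun n : ℕ => ⨆ j ∈ Finset.Icc 1 (n - 1), sgap ζ n j / Hfun ζ n j)
      atTop (nhds 0)) :
    Tendsto (fun n : ℕ =>
        (∏ k ∈ Finset.range (n + 1), ∏ j ∈ Finset.range k, |a j - a k|) ^
          (2 / ((n : ℝ) * ((n : ℝ) + 1))))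
      atTop (nhds (1 / 4)) := by
  set ε : ℕ → ℝ := fun n => ⨆ j ∈ Finset.Icc 1 (n - 1), sgap ζ n j / Hfun ζ n j with hε
  have hpos : ∀ n, 0 < |lejaPoly a n (a n)| := fun n =>
    abs_pos.mpr (Finset.prod_ne_zero_iff.mpr fun j hj =>
      sub_ne_zero.mpr (hinj.ne (Finset.mem_range.mp hj).ne'))
  have hlow : ∀ k : ℕ, -(k * Real.log 4) - k * |ε k| ≤ Real.log |lejaPoly a k (a k)| := by
    intro k
    have hk4 : 0 ≤ (k : ℝ) * Real.log 4 := mul_nonneg k.cast_nonneg (Real.log_nonneg (by norm_num))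
    rcases lt_or_ge k 2 with hk | hk
    · have hp : |lejaPoly a k (a k)| = 1 := by
        interval_cases k <;> simp [lejaPoly, ha0, ha1]
      rw [hp, Real.log_one]
      linarith [mul_nonneg k.cast_nonneg (abs_nonneg (ε k))]
    · have h := inv_four_pow_le_of_lejaPoly_le a k (mul_pos (hpos k) (Real.exp_pos (k * ε k)))
        fun x hx => abs_lejaPoly_le_mul_exp hk ha0 ha1 (hleja k hk).2 ζ (hζmono k hk)
          (hζimage k hk) hinj hx
      have h' := Real.log_le_log (by positivity) h
      rw [Real.log_mul (hpos k).ne' (Real.exp_pos _).ne', Real.log_exp, Real.log_inv,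
        Real.log_pow] at h'
      linarith [mul_le_mul_of_nonneg_left (le_abs_self (ε k)) (k.cast_nonneg (α := ℝ))]
  have hsumlow : ∀ n : ℕ, -(n * (n + 1) / 2 * Real.log 4) - n * ∑ k ∈ Finset.range (n + 1), |ε k|
      ≤ ∑ k ∈ Finset.range (n + 1), Real.log |lejaPoly a k (a k)| := by
    intro n
    have h1 := Finset.sum_le_sum fun k (_ : k ∈ Finset.range (n + 1)) => hlow k
    rw [Finset.sum_sub_distrib, Finset.sum_neg_distrib, ← Finset.sum_mul,
      sum_range_succ_cast_eq] at h1
    have h2 : ∑ k ∈ Finset.range (n + 1), (k : ℝ) * |ε k|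
        ≤ n * ∑ k ∈ Finset.range (n + 1), |ε k| := by
      rw [Finset.mul_sum]
      refine Finset.sum_le_sum fun k hk => ?_
      have : (k : ℝ) ≤ n := by exact_mod_cast Nat.lt_succ_iff.mp (Finset.mem_range.mp hk)
      gcongr
    linarith
  have hlim : Tendsto (fun n : ℕ => (∑ k ∈ Finset.range (n + 1), Real.log |lejaPoly a k (a k)|) *
      (2 / ((n : ℝ) * ((n : ℝ) + 1)))) atTop (nhds (-Real.log 4)) := by
    have hces : Tendsto (fun n : ℕ => -Real.log 4 -
        2 * (((n + 1 : ℕ) : ℝ)⁻¹ * ∑ k ∈ Finset.range (n + 1), |ε k|)) atTop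
        (nhds (-Real.log 4)) := by
      have h := (tendsto_add_atTop_iff_nat 1).mpr (Filter.Tendsto.cesaro (by simpa using hstar.abs))
      simpa using (h.const_mul 2).const_sub (-Real.log 4)
    have hlog : Tendsto (fun n : ℕ => 2 * ((Real.log ((n : ℝ) + 1) + Real.log 2) / n) -
        Real.log 4) atTop (nhds (-Real.log 4)) := by
      have h1 : Tendsto (fun n : ℕ => Real.log ((n : ℝ) + 1) / n) atTop (nhds 0) := by
        have h := Real.isLittleO_log_id_atTop.tendsto_div_nhds_zero.comp
          (tendsto_natCast_atTop_atTop.comp (tendsto_add_atTop_nat 1) :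
            Tendsto (fun n : ℕ => ((n + 1 : ℕ) : ℝ)) atTop atTop)
        have h' := h.mul (tendsto_one_div_atTop_nhds_zero_nat.const_add (1 : ℝ))
        rw [add_zero, mul_one] at h'
        refine h'.congr' ?_
        filter_upwards [eventually_gt_atTop 0] with n hn
        have hn0 : (0 : ℝ) < n := by exact_mod_cast hn
        simp only [Function.comp, id, Nat.cast_add, Nat.cast_one]
        field_simp
      have h2 := h1.add (tendsto_const_div_atTop_nhds_zero_nat (Real.log 2))
      simpa [add_div] using (h2.const_mul 2).sub_const (Real.log 4)
    refine tendsto_of_tendsto_of_tendsto_of_le_of_le' hces hlog ?_ ?_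
    · filter_upwards [eventually_gt_atTop 0] with n hn
      have hn0 : (0 : ℝ) < n := by exact_mod_cast hn
      refine le_trans (le_of_eq ?_) (mul_le_mul_of_nonneg_right (hsumlow n) (by positivity))
      push_cast
      field_simp
    · filter_upwards [eventually_gt_atTop 0] with n hn
      have hn0 : (0 : ℝ) < n := by exact_mod_cast hn
      refine le_trans (mul_le_mul_of_nonneg_right (sum_log_abs_lejaPoly_le a hmem hpos n)
        (by positivity)) (le_of_eq ?_)
      field_simp
  have hfin := (Real.continuous_exp.tendsto _).comp hlim
  rw [Real.exp_neg, Real.exp_log (by norm_num), ← one_div] at hfin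
  refine hfin.congr fun n => ?_
  have hprod : ∏ k ∈ Finset.range (n + 1), ∏ j ∈ Finset.range k, |a j - a k|
      = ∏ k ∈ Finset.range (n + 1), |lejaPoly a k (a k)| :=
    Finset.prod_congr rfl fun k _ => by
      rw [lejaPoly, Finset.abs_prod]
      exact Finset.prod_congr rfl fun j _ => abs_sub_comm _ _
  rw [hprod, Real.rpow_def_of_pos (Finset.prod_pos fun k _ => hpos k),
    Real.log_prod fun k _ => (hpos k).ne', Function.comp]
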